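/- The bilateral adding machine map f_α : Δ → Δ is a homeomorphism: it is bijective, continuous, and its inverse is continuous. -/

import Mathlib

/-- The bilateral adding machine space `Δ`: a point `(u, v)` is a bisequence with
negative coordinates `x_{-(n+1)} := u n ∈ ZMod 2` and nonnegative coordinates
`x_n := v n ∈ ZMod j` (identifying `Fin 2` with `ZMod 2` and `Fin j` with `ZMod j`). -/
abbrev AddingMachineSpace (j : ℕ) : Type := (ℕ → ZMod 2) × (ℕ → ZMod j)

/-- The carries on the nonnegative side: `c 0 = 1` and `c (n+1) = 1` if
`(v n).val + (c n).val ≥ j`, and `0` otherwise. -/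
def carryPos (j : ℕ) (v : ℕ → ZMod j) : ℕ → ZMod j
  | 0 => 1
  | n + 1 => if j ≤ (v n).val + (carryPos j v n).val then 1 else 0

/-- The carries on the negative side: `s 0 = τ (v 0 + 1)` and `s (n+1) = 1` if
`(u n).val + (s n).val ≥ 2`, and `0` otherwise. -/
def carryNeg (j : ℕ) (τ : ZMod j → ZMod 2) (u : ℕ → ZMod 2) (v : ℕ → ZMod j) :
    ℕ → ZMod 2
  | 0 => τ (v 0 + 1)
  | n + 1 => if 2 ≤ (u n).val + (carryNeg j τ u v n).val then 1 else 0

/-- The bilateral adding machine map `f_α : Δ → Δ`. -/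
def addingMachine (j : ℕ) (τ : ZMod j → ZMod 2) (x : AddingMachineSpace j) :
    AddingMachineSpace j :=
  (fun n => x.1 n + carryNeg j τ x.1 x.2 n, fun n => x.2 n + carryPos j x.2 n)

/-- Carries on the nonnegative side, recovered from the image. -/
def icarryPos (j : ℕ) (w : ℕ → ZMod j) : ℕ → ZMod j
  | 0 => 1
  | n + 1 => if j ≤ (w n - icarryPos j w n).val + (icarryPos j w n).val then 1 else 0

/-- Carries on the negative side, recovered from the image. -/
def icarryNeg (j : ℕ) (τ : ZMod j → ZMod 2) (t : ℕ → ZMod 2) (w : ℕ → ZMod j) :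
    ℕ → ZMod 2
  | 0 => τ (w 0)
  | n + 1 => if 2 ≤ (t n - icarryNeg j τ t w n).val + (icarryNeg j τ t w n).val then 1 else 0

/-- The inverse map. -/
def iaddingMachine (j : ℕ) (τ : ZMod j → ZMod 2) (x : AddingMachineSpace j) :
    AddingMachineSpace j :=
  (fun n => x.1 n - icarryNeg j τ x.1 x.2 n, fun n => x.2 n - icarryPos j x.2 n)

theorem cont_comp_two {X A B C : Type*} [TopologicalSpace X] [TopologicalSpace A]
    [TopologicalSpace B] [TopologicalSpace C] [DiscreteTopology A] [DiscreteTopology B]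
    (F : A → B → C) {a : X → A} {b : X → B} (ha : Continuous a) (hb : Continuous b) :
    Continuous fun x => F (a x) (b x) :=
  (continuous_of_discreteTopology (f := fun p : A × B => F p.1 p.2)).comp (ha.prodMk hb)

theorem cont_fst (j n : ℕ) : Continuous fun x : AddingMachineSpace j => x.1 n :=
  (continuous_apply n).comp continuous_fst

theorem cont_snd (j n : ℕ) : Continuous fun x : AddingMachineSpace j => x.2 n :=
  (continuous_apply n).comp continuous_snd

theorem cont_carryPos (j n : ℕ) :
    Continuous fun x : AddingMachineSpace j => carryPos j x.2 n := by
  induction n with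
  | zero => exact continuous_const
  | succ n ih =>
    exact cont_comp_two (fun a b : ZMod j => if j ≤ a.val + b.val then (1 : ZMod j) else 0)
      (cont_snd j n) ih

theorem cont_icarryPos (j n : ℕ) :
    Continuous fun x : AddingMachineSpace j => icarryPos j x.2 n := by
  induction n with
  | zero => exact continuous_const
  | succ n ih =>
    exact cont_comp_two
      (fun a b : ZMod j => if j ≤ (a - b).val + b.val then (1 : ZMod j) else 0)
      (cont_snd j n) ih

theorem cont_carryNeg (j : ℕ) (τ : ZMod j → ZMod 2) (n : ℕ) :
    Continuous fun x : AddingMachineSpace j => carryNeg j τ x.1 x.2 n := by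
  induction n with
  | zero =>
    exact (continuous_of_discreteTopology (f := fun a : ZMod j => τ (a + 1))).comp (cont_snd j 0)
  | succ n ih =>
    exact cont_comp_two (fun a b : ZMod 2 => if 2 ≤ a.val + b.val then (1 : ZMod 2) else 0)
      (cont_fst j n) ih

theorem cont_icarryNeg (j : ℕ) (τ : ZMod j → ZMod 2) (n : ℕ) :
    Continuous fun x : AddingMachineSpace j => icarryNeg j τ x.1 x.2 n := by
  induction n with
  | zero =>
    exact (continuous_of_discreteTopology (f := τ)).comp (cont_snd j 0)
  | succ n ih =>
    exact cont_comp_two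
      (fun a b : ZMod 2 => if 2 ≤ (a - b).val + b.val then (1 : ZMod 2) else 0)
      (cont_fst j n) ih

theorem cont_addingMachine (j : ℕ) (τ : ZMod j → ZMod 2) : Continuous (addingMachine j τ) :=
  (continuous_pi fun n => cont_comp_two (· + ·) (cont_fst j n) (cont_carryNeg j τ n)).prodMk
    (continuous_pi fun n => cont_comp_two (· + ·) (cont_snd j n) (cont_carryPos j n))

theorem cont_iaddingMachine (j : ℕ) (τ : ZMod j → ZMod 2) : Continuous (iaddingMachine j τ) :=
  (continuous_pi fun n => cont_comp_two (· - ·) (cont_fst j n) (cont_icarryNeg j τ n)).prodMk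
    (continuous_pi fun n => cont_comp_two (· - ·) (cont_snd j n) (cont_icarryPos j n))

theorem icarryPos_image (j : ℕ) (v : ℕ → ZMod j) (n : ℕ) :
    icarryPos j (fun n => v n + carryPos j v n) n = carryPos j v n := by
  induction n with
  | zero => rfl
  | succ n ih => simp only [icarryPos, carryPos, ih, add_sub_cancel_right]

theorem carryPos_preimage (j : ℕ) (w : ℕ → ZMod j) (n : ℕ) :
    carryPos j (fun n => w n - icarryPos j w n) n = icarryPos j w n := by
  induction n with
  | zero => rfl
  | succ n ih => simp only [icarryPos, carryPos, ih]

theorem icarryNeg_image (j : ℕ) (τ : ZMod j → ZMod 2) (u : ℕ → ZMod 2) (v : ℕ → ZMod j) (n : ℕ) :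
    icarryNeg j τ (fun n => u n + carryNeg j τ u v n) (fun n => v n + carryPos j v n) n
      = carryNeg j τ u v n := by
  induction n with
  | zero => rfl
  | succ n ih => simp only [icarryNeg, carryNeg, ih, add_sub_cancel_right]

theorem carryNeg_preimage (j : ℕ) (τ : ZMod j → ZMod 2) (t : ℕ → ZMod 2) (w : ℕ → ZMod j)
    (n : ℕ) :
    carryNeg j τ (fun n => t n - icarryNeg j τ t w n) (fun n => w n - icarryPos j w n) n
      = icarryNeg j τ t w n := by
  induction n with
  | zero => simp only [icarryNeg, carryNeg, icarryPos, sub_add_cancel]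
  | succ n ih => simp only [icarryNeg, carryNeg, ih]

/-- The bilateral adding machine map `f_α : Δ → Δ` is a homeomorphism: it is
bijective, continuous, and its inverse is continuous. -/
theorem addingMachine_isHomeomorph (j : ℕ) (hj : 2 ≤ j) (τ : ZMod j → ZMod 2)
    (hτ : Function.Surjective τ) :
    IsHomeomorph (addingMachine j τ) := by
  refine isHomeomorph_iff_exists_inverse.2
    ⟨cont_addingMachine j τ, iaddingMachine j τ, ?_, ?_, cont_iaddingMachine j τ⟩
  · intro x
    refine Prod.ext (funext fun n => ?_) (funext fun n => ?_)
    · simp only [iaddingMachine, addingMachine, icarryNeg_image, add_sub_cancel_right]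
    · simp only [iaddingMachine, addingMachine, icarryPos_image, add_sub_cancel_right]
  · intro x
    refine Prod.ext (funext fun n => ?_) (funext fun n => ?_)
    · simp only [iaddingMachine, addingMachine, carryNeg_preimage, sub_add_cancel]
    · simp only [iaddingMachine, addingMachine, carryPos_preimage, sub_add_cancel]
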